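/- For every j ∈ ℕ₀ there are constants c, C > 0 depending only on α, n, j such that for every nonnegative measurable f on (0,∞) and every t ∈ (0,∞): c·[(H_α^{j+1}∘P)f(t) + R_α^{j+1}f(t)] ≤ (H_α∘P)^{j+1} f(t) ≤ C·[(H_α^{j+1}∘P)f(t/2^j) + R_α^{j+1}f(2^j t)]. -/

import Mathlib

open MeasureTheory Set Real
open scoped ENNReal

noncomputable def phi (n : ℕ) (α : ℝ) (t : ℝ) : ℝ := min (t ^ (-1 + α / n)) t⁻¹

noncomputable def Pop (f : ℝ → ℝ≥0∞) (t : ℝ) : ℝ≥0∞ :=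
  (∫⁻ s in Set.Ioo (0 : ℝ) t, f s) / ENNReal.ofReal t

noncomputable def Rop (n : ℕ) (α : ℝ) (f : ℝ → ℝ≥0∞) (t : ℝ) : ℝ≥0∞ :=
  ENNReal.ofReal (phi n α t) * ∫⁻ s in Set.Ioo (0 : ℝ) t, f s

noncomputable def Hop (n : ℕ) (α : ℝ) (f : ℝ → ℝ≥0∞) (t : ℝ) : ℝ≥0∞ :=
  ∫⁻ s in Set.Ioi t, f s * ENNReal.ofReal (phi n α s)

/-- The composition `H_α ∘ P`. -/
noncomputable def HP (n : ℕ) (α : ℝ) (f : ℝ → ℝ≥0∞) : ℝ → ℝ≥0∞ :=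
  Hop n α (Pop f)

/-- The increasing weight `t φ(t)`. -/
noncomputable def ww (a t : ℝ) : ℝ := min (t ^ a) 1

/-- Explicit primitive of `φ`. -/
noncomputable def AA (a t : ℝ) : ℝ := (min t 1) ^ a / a + Real.log (max t 1)

lemma phi_eq (n : ℕ) (α t : ℝ) (ht : 0 < t) : phi n α t = ww (α / n) t / t := by
  unfold phi ww
  rw [Real.rpow_add ht, Real.rpow_neg_one, ← min_div_div_right ht.le]
  congr 1
  · field_simp
  · simp

lemma ww_pos {a t : ℝ} (ht : 0 < t) : 0 < ww a t := by
  unfold ww; positivity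

lemma ww_le_one (a t : ℝ) : ww a t ≤ 1 := min_le_right _ _

lemma ww_mono {a s t : ℝ} (ha : 0 < a) (hs : 0 < s) (hst : s ≤ t) : ww a s ≤ ww a t := by
  unfold ww
  gcongr

lemma ww_half {a t : ℝ} (ha : 0 < a) (ha1 : a < 1) (ht : 0 < t) : ww a t ≤ 2 * ww a (t / 2) := by
  unfold ww
  rw [Real.div_rpow ht.le (by norm_num)]
  have h2 : (2:ℝ) ^ a ≤ 2 := by
    calc (2:ℝ) ^ a ≤ 2 ^ (1:ℝ) := by gcongr; norm_num
      _ = 2 := by simp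
  have h2' : (0:ℝ) < 2 ^ a := by positivity
  have h3 : 0 < t ^ a := by positivity
  rcases min_cases (t ^ a / 2 ^ a) 1 with ⟨h, _⟩ | ⟨h, _⟩ <;> rw [h]
  · refine (min_le_left _ _).trans ?_
    rw [← mul_div_assoc, le_div_iff₀ h2']
    nlinarith
  · exact (min_le_right _ _).trans (by norm_num)

lemma phi_nonneg (n : ℕ) (α t : ℝ) (ht : 0 < t) : 0 ≤ phi n α t := by
  unfold phi; positivity

lemma phi_measurable (n : ℕ) (α : ℝ) : Measurable (phi n α) := by
  unfold phi; fun_prop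

lemma AA_measurable (a : ℝ) : Measurable (AA a) := by
  unfold AA; fun_prop

lemma AA_cont {a : ℝ} : ContinuousOn (AA a) (Ioi 0) := by
  intro t ht
  have ht : 0 < t := ht
  unfold AA
  apply ContinuousAt.continuousWithinAt
  apply ContinuousAt.add
  · apply ContinuousAt.div_const
    apply ContinuousAt.rpow_const (by fun_prop)
    left; positivity
  · apply ContinuousAt.log (by fun_prop)
    positivity

lemma phi_cont (n : ℕ) (α : ℝ) : ContinuousOn (phi n α) (Ioi 0) := by
  intro t ht
  have ht : 0 < t := ht
  unfold phi
  apply ContinuousAt.continuousWithinAt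
  refine Filter.Tendsto.min ?_ ?_
  · apply ContinuousAt.rpow_const (by fun_prop)
    left; positivity
  · apply continuousAt_inv₀ ht.ne'

lemma AA_deriv_ne (n : ℕ) (α t : ℝ) (ha : 0 < α / n) (ht : 0 < t) (h1 : t ≠ 1) :
    HasDerivAt (AA (α / n)) (phi n α t) t := by
  set a := α / n with hadef
  rw [phi_eq n α t ht, ← hadef]
  rcases lt_or_gt_of_ne h1 with h | h
  · have e1 : AA a =ᶠ[nhds t] fun x => x ^ a / a := by
      filter_upwards [Iio_mem_nhds h] with x hx
      have hx : x < 1 := hx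
      simp [AA, min_eq_left hx.le, max_eq_right hx.le]
    refine HasDerivAt.congr_of_eventuallyEq ?_ e1
    have := (Real.hasDerivAt_rpow_const (x := t) (p := a) (Or.inl ht.ne')).div_const a
    refine this.congr_deriv (Eq.symm ?_)
    have : t ^ a ≤ 1 := Real.rpow_le_one ht.le h.le ha.le
    rw [ww, min_eq_left this, Real.rpow_sub ht, Real.rpow_one]
    field_simp
  · have e1 : AA a =ᶠ[nhds t] fun x => 1 / a + Real.log x := by
      filter_upwards [Ioi_mem_nhds h] with x hx
      have hx : 1 < x := hx
      simp [AA, min_eq_right hx.le, max_eq_left hx.le]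
    refine HasDerivAt.congr_of_eventuallyEq ?_ e1
    have := (Real.hasDerivAt_log ht.ne').const_add (1 / a)
    convert this using 1
    have : 1 ≤ t ^ a := Real.one_le_rpow h.le ha.le
    rw [ww, min_eq_right this]; simp

lemma AA_deriv (n : ℕ) (α t : ℝ) (ha : 0 < α / n) (ht : 0 < t) :
    HasDerivAt (AA (α / n)) (phi n α t) t := by
  by_cases h1 : t = 1
  · subst h1
    have hp : phi n α 1 = 1 := by simp [phi]
    rw [hp]
    have e1 : HasDerivWithinAt (AA (α / n)) 1 (Iic 1) 1 := by
      have := (Real.hasDerivAt_rpow_const (x := 1) (p := α / n) (Or.inl one_ne_zero)).div_const (α / n)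
      rw [Real.one_rpow, mul_one, div_self ha.ne'] at this
      refine this.hasDerivWithinAt.congr (fun x hx => ?_) ?_
      · have hx : x ≤ 1 := hx
        simp [AA, min_eq_left hx, max_eq_right hx]
      · simp [AA]
    have e2 : HasDerivWithinAt (AA (α / n)) 1 (Ici 1) 1 := by
      have := (Real.hasDerivAt_log (one_ne_zero)).const_add (1 / (α / n))
      rw [inv_one] at this
      refine this.hasDerivWithinAt.congr (fun x hx => ?_) ?_
      · have hx : 1 ≤ x := hx
        simp [AA, min_eq_right hx, max_eq_left hx]
      · simp [AA]
    have := e1.union e2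
    rwa [Iic_union_Ici, hasDerivWithinAt_univ] at this
  · exact AA_deriv_ne n α t ha ht h1

lemma AA_mono {a : ℝ} (ha : 0 < a) {s t : ℝ} (hs : 0 < s) (hst : s ≤ t) : AA a s ≤ AA a t := by
  unfold AA; gcongr

/-- upper and lower log bounds -/
lemma AA_sub_le (n : ℕ) (α s u : ℝ) (ha : 0 < α / n) (hs : 0 < s) (hsu : s ≤ u) :
    AA (α / n) u - AA (α / n) s ≤ ww (α / n) u * Real.log (u / s) := by
  have hu : 0 < u := hs.trans_le hsu
  have hm : MonotoneOn (fun r => ww (α / n) u * Real.log r - AA (α / n) r) (Icc s u) := by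
    have hd : ∀ r ∈ Icc s u, HasDerivAt (fun r => ww (α / n) u * Real.log r - AA (α / n) r)
        (ww (α / n) u * r⁻¹ - phi n α r) r := by
      intro r hr
      have hr0 : 0 < r := hs.trans_le hr.1
      exact ((Real.hasDerivAt_log hr0.ne').const_mul _).sub (AA_deriv n α r ha hr0)
    apply monotoneOn_of_hasDerivWithinAt_nonneg (convex_Icc s u) (f' := fun r => ww (α / n) u * r⁻¹ - phi n α r)
    · exact fun r hr => (hd r hr).continuousAt.continuousWithinAt
    · exact fun r hr => (hd r (interior_subset hr)).hasDerivWithinAt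
    · intro r hr
      have hr := interior_subset hr
      have hr0 : 0 < r := hs.trans_le hr.1
      rw [phi_eq n α r hr0, ← div_eq_mul_inv, sub_nonneg]
      have := ww_mono ha hr0 hr.2
      gcongr
  have := hm (left_mem_Icc.2 hsu) (right_mem_Icc.2 hsu) hsu
  simp only at this
  rw [Real.log_div hu.ne' hs.ne']
  linarith

lemma le_AA_sub (n : ℕ) (α s u : ℝ) (ha : 0 < α / n) (hs : 0 < s) (hsu : s ≤ u) :
    ww (α / n) s * Real.log (u / s) ≤ AA (α / n) u - AA (α / n) s := by
  have hu : 0 < u := hs.trans_le hsu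
  have hm : MonotoneOn (fun r => AA (α / n) r - ww (α / n) s * Real.log r) (Icc s u) := by
    have hd : ∀ r ∈ Icc s u, HasDerivAt (fun r => AA (α / n) r - ww (α / n) s * Real.log r)
        (phi n α r - ww (α / n) s * r⁻¹) r := by
      intro r hr
      have hr0 : 0 < r := hs.trans_le hr.1
      exact (AA_deriv n α r ha hr0).sub ((Real.hasDerivAt_log hr0.ne').const_mul _)
    apply monotoneOn_of_hasDerivWithinAt_nonneg (convex_Icc s u) (f' := fun r => phi n α r - ww (α / n) s * r⁻¹)
    · exact fun r hr => (hd r hr).continuousAt.continuousWithinAt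
    · exact fun r hr => (hd r (interior_subset hr)).hasDerivWithinAt
    · intro r hr
      have hr := interior_subset hr
      have hr0 : 0 < r := hs.trans_le hr.1
      rw [phi_eq n α r hr0, ← div_eq_mul_inv, sub_nonneg]
      have := ww_mono ha hs hr.1
      gcongr
  have := hm (left_mem_Icc.2 hsu) (right_mem_Icc.2 hsu) hsu
  simp only at this
  rw [Real.log_div hu.ne' hs.ne']
  linarith

lemma AA_double (n : ℕ) (α t : ℝ) (ha : 0 < α / n) (ht : 0 < t) :
    ww (α / n) t ≤ 2 * (AA (α / n) (2 * t) - AA (α / n) t) := by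
  have := le_AA_sub n α t (2 * t) ha ht (by linarith)
  rw [mul_div_assoc, div_self ht.ne', mul_one] at this
  have h2 := Real.log_two_gt_d9
  have h3 := ww_pos (a := α / n) ht
  nlinarith

lemma AA_half (n : ℕ) (α t : ℝ) (ha : 0 < α / n) (ha1 : α / n < 1) (ht : 0 < t) :
    ww (α / n) t ≤ 4 * (AA (α / n) t - AA (α / n) (t / 2)) := by
  have := AA_double n α (t / 2) ha (by positivity)
  rw [mul_div_cancel₀ _ (by norm_num)] at this
  have := ww_half ha ha1 ht
  linarith

lemma log_pow_bound (k : ℕ) : ∃ C : ℝ, 0 < C ∧ ∀ x : ℝ, 1 ≤ x →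
    (1 + 2 * Real.log x) ^ k ≤ C * x ^ (1 / 2 : ℝ) := by
  refine ⟨4 ^ k * k.factorial * Real.exp (1 / 4), by positivity, fun x hx => ?_⟩
  have hl := Real.log_nonneg hx
  have := Real.pow_div_factorial_le_exp ((1 + 2 * Real.log x) / 4) (by positivity) k
  rw [div_le_iff₀ (by positivity), div_pow, div_le_iff₀ (by positivity)] at this
  refine this.trans (le_of_eq ?_)
  rw [Real.rpow_def_of_pos (by linarith), show (1 + 2 * Real.log x) / 4 = 1/4 + Real.log x * (1/2) by ring, Real.exp_add]
  ring

lemma lint_rpow (p t : ℝ) (hp : 0 < p) (ht : 0 < t) :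
    ∫⁻ r in Ioo 0 t, ENNReal.ofReal (r ^ (p - 1)) = ENNReal.ofReal (t ^ p / p) := by
  have hi := intervalIntegral.intervalIntegrable_rpow' (a := 0) (b := t) (r := p - 1) (by linarith)
  have he := integral_rpow (a := 0) (b := t) (r := p - 1) (Or.inl (by linarith))
  rw [intervalIntegral.integral_of_le ht.le] at he
  rw [intervalIntegrable_iff_integrableOn_Ioc_of_le ht.le] at hi
  rw [restrict_Ioo_eq_restrict_Ioc, ← ofReal_integral_eq_lintegral_ofReal hi, he]
  · simp [hp.ne']
  · filter_upwards [ae_restrict_mem measurableSet_Ioc] with r hr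
    have := hr.1
    simp; positivity

lemma lint_tail (t : ℝ) (ht : 0 < t) :
    ∫⁻ r in Ioi t, ENNReal.ofReal (r ^ (-3/2 : ℝ)) = ENNReal.ofReal (2 * t ^ (-1/2 : ℝ)) := by
  have hi := integrableOn_Ioi_rpow_of_lt (a := -3/2) (by norm_num) ht
  have he := integral_Ioi_rpow_of_lt (a := -3/2) (by norm_num) ht
  rw [← ofReal_integral_eq_lintegral_ofReal hi, he]
  · congr 1; norm_num; ring
  · filter_upwards [ae_restrict_mem measurableSet_Ioi] with r hr
    have : 0 < r := ht.trans hr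
    simp; positivity

lemma ftc (F F' : ℝ → ℝ) (s u : ℝ) (hs : 0 < s) (hsu : s ≤ u)
    (hd : ∀ r, 0 < r → HasDerivAt F (F' r) r) (hc : ContinuousOn F' (Ioi 0))
    (hn : ∀ r ∈ Ioo s u, 0 ≤ F' r) :
    ∫⁻ r in Ioo s u, ENNReal.ofReal (F' r) = ENNReal.ofReal (F u - F s) := by
  have hsub : uIcc s u ⊆ Ioi 0 := by
    rw [uIcc_of_le hsu]; exact fun r hr => hs.trans_le hr.1
  have hi : IntervalIntegrable F' volume s u := (hc.mono hsub).intervalIntegrable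
  have he := intervalIntegral.integral_eq_sub_of_hasDerivAt (fun r hr => hd r (hsub hr)) hi
  rw [intervalIntegral.integral_of_le hsu, ← restrict_Ioo_eq_restrict_Ioc] at he
  rw [intervalIntegrable_iff_integrableOn_Ioo_of_le hsu] at hi
  rw [← ofReal_integral_eq_lintegral_ofReal hi, he]
  filter_upwards [ae_restrict_mem measurableSet_Ioo] with r hr
  exact hn r hr

lemma ftc_phi (n : ℕ) (α s u : ℝ) (ha : 0 < α / n) (hs : 0 < s) (hsu : s ≤ u) :
    ∫⁻ r in Ioo s u, ENNReal.ofReal (phi n α r)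
      = ENNReal.ofReal (AA (α / n) u - AA (α / n) s) :=
  ftc (AA (α / n)) (phi n α) s u hs hsu (fun r hr => AA_deriv n α r ha hr) (phi_cont n α)
    (fun r hr => phi_nonneg n α r (hs.trans hr.1))

/-- `∫_s^u φ(r) (A u - A r)^k dr`. -/
lemma ftc_pow_left (n : ℕ) (α s u : ℝ) (k : ℕ) (ha : 0 < α / n) (hs : 0 < s) (hsu : s ≤ u) :
    ((k + 1 : ℕ) : ℝ≥0∞) * ∫⁻ r in Ioo s u, ENNReal.ofReal (phi n α r) * ENNReal.ofReal ((AA (α / n) u - AA (α / n) r) ^ k)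
      = ENNReal.ofReal ((AA (α / n) u - AA (α / n) s) ^ (k + 1)) := by
  have := ftc (fun r => -(AA (α / n) u - AA (α / n) r) ^ (k + 1))
    (fun r => ((k + 1 : ℕ) : ℝ) * (phi n α r * (AA (α / n) u - AA (α / n) r) ^ k)) s u hs hsu ?_ ?_ ?_
  · simp only [sub_self, ne_eq, Nat.succ_ne_zero, not_false_eq_true, zero_pow, neg_zero, zero_sub, neg_neg] at this
    rw [← this, ← lintegral_const_mul' _ _ (by simp)]
    apply setLIntegral_congr_fun measurableSet_Ioo
    intro r hr
    have hr0 := hs.trans hr.1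
    have := AA_mono ha hr0 hr.2.le
    have h1 := phi_nonneg n α r hr0
    beta_reduce
    rw [ENNReal.ofReal_mul (by positivity), ENNReal.ofReal_mul h1, ENNReal.ofReal_natCast]
  · intro r hr
    have := (((AA_deriv n α r ha hr).const_sub (AA (α / n) u)).pow (k + 1)).neg
    refine this.congr_deriv ?_
    push_cast; ring
  · have := AA_cont (a := α / n)
    have := phi_cont n α
    fun_prop
  · intro r hr
    have hr0 := hs.trans hr.1
    have := AA_mono ha hr0 hr.2.le
    have h1 := phi_nonneg n α r hr0
    have : 0 ≤ AA (α / n) u - AA (α / n) r := by linarith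
    positivity

/-- `∫_s^u φ(r) (A r - A s)^k dr`. -/
lemma ftc_pow_right (n : ℕ) (α s u : ℝ) (k : ℕ) (ha : 0 < α / n) (hs : 0 < s) (hsu : s ≤ u) :
    ((k + 1 : ℕ) : ℝ≥0∞) * ∫⁻ r in Ioo s u, ENNReal.ofReal (phi n α r) * ENNReal.ofReal ((AA (α / n) r - AA (α / n) s) ^ k)
      = ENNReal.ofReal ((AA (α / n) u - AA (α / n) s) ^ (k + 1)) := by
  have := ftc (fun r => (AA (α / n) r - AA (α / n) s) ^ (k + 1))
    (fun r => ((k + 1 : ℕ) : ℝ) * (phi n α r * (AA (α / n) r - AA (α / n) s) ^ k)) s u hs hsu ?_ ?_ ?_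
  · simp only [sub_self, ne_eq, Nat.succ_ne_zero, not_false_eq_true, zero_pow, sub_zero] at this
    rw [← this, ← lintegral_const_mul' _ _ (by simp)]
    apply setLIntegral_congr_fun measurableSet_Ioo
    intro r hr
    have hr0 := hs.trans hr.1
    have h1 := phi_nonneg n α r hr0
    beta_reduce
    rw [ENNReal.ofReal_mul (by positivity), ENNReal.ofReal_mul h1, ENNReal.ofReal_natCast]
  · intro r hr
    have := (((AA_deriv n α r ha hr).sub_const (AA (α / n) s)).pow (k + 1))
    refine this.congr_deriv ?_
    push_cast; ring
  · have := AA_cont (a := α / n)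
    have := phi_cont n α
    fun_prop
  · intro r hr
    have hr0 := hs.trans hr.1
    have := AA_mono ha hs hr.1.le
    have h1 := phi_nonneg n α r hr0
    have : 0 ≤ AA (α / n) r - AA (α / n) s := by linarith
    positivity

lemma tonelli (F : ℝ → ℝ → ℝ≥0∞) (hF : Measurable (Function.uncurry F)) (S S' : Set ℝ)
    (T T' : ℝ → Set ℝ) (hE : MeasurableSet {p : ℝ × ℝ | p.1 ∈ S ∧ p.2 ∈ T p.1})
    (hS : MeasurableSet S) (hS' : MeasurableSet S') (hT : ∀ s, MeasurableSet (T s))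
    (hT' : ∀ s, MeasurableSet (T' s)) (h : ∀ s u, (s ∈ S ∧ u ∈ T s) ↔ (u ∈ S' ∧ s ∈ T' u)) :
    ∫⁻ s in S, ∫⁻ u in T s, F s u = ∫⁻ u in S', ∫⁻ s in T' u, F s u := by
  classical
  set E := {p : ℝ × ℝ | p.1 ∈ S ∧ p.2 ∈ T p.1} with hEdef
  have h1 : ∫⁻ s in S, ∫⁻ u in T s, F s u
      = ∫⁻ s, ∫⁻ u, E.indicator (Function.uncurry F) (s, u) := by
    rw [← lintegral_indicator hS]
    congr 1; ext s
    by_cases hs : s ∈ S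
    · rw [indicator_of_mem hs, ← lintegral_indicator (hT s)]
      congr 1; ext u
      simp [indicator, hEdef, hs]
    · simp [indicator, hEdef, hs]
  have h2 : ∫⁻ u in S', ∫⁻ s in T' u, F s u
      = ∫⁻ u, ∫⁻ s, E.indicator (Function.uncurry F) (s, u) := by
    rw [← lintegral_indicator hS']
    congr 1; ext u
    by_cases hs : u ∈ S'
    · rw [indicator_of_mem hs, ← lintegral_indicator (hT' u)]
      congr 1; ext s
      simp [indicator, hEdef, hs, h]
    · simp [indicator, hEdef, hs, h]
  rw [h1, h2]
  exact lintegral_lintegral_swap (hF.indicator hE).aemeasurable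

/-- The primitive of `f`. -/
noncomputable def GG (f : ℝ → ℝ≥0∞) (t : ℝ) : ℝ≥0∞ := ∫⁻ s in Ioo 0 t, f s

lemma GG_mono (f : ℝ → ℝ≥0∞) : Monotone (GG f) := fun _ _ h =>
  lintegral_mono_set (Ioo_subset_Ioo_right h)

lemma GG_meas (f : ℝ → ℝ≥0∞) : Measurable (GG f) := (GG_mono f).measurable

lemma Pop_meas (f : ℝ → ℝ≥0∞) : Measurable (Pop f) :=
  (GG_meas f).div ENNReal.measurable_ofReal

lemma Rop_meas (n : ℕ) (α : ℝ) (f : ℝ → ℝ≥0∞) : Measurable (Rop n α f) :=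
  ((phi_measurable n α).ennreal_ofReal).mul (GG_meas f)

lemma Hop_anti (n : ℕ) (α : ℝ) (f : ℝ → ℝ≥0∞) : Antitone (Hop n α f) := fun _ _ h =>
  lintegral_mono_set (Ioi_subset_Ioi h)

lemma Hop_meas (n : ℕ) (α : ℝ) (f : ℝ → ℝ≥0∞) : Measurable (Hop n α f) :=
  (Hop_anti n α f).measurable

lemma H_iter (n : ℕ) (α : ℝ) (ha : 0 < α / n) (g : ℝ → ℝ≥0∞) (hg : Measurable g) (k : ℕ) :
    ∀ t : ℝ, 0 < t → (k.factorial : ℝ≥0∞) * (Hop n α)^[k + 1] g t =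
      ∫⁻ u in Ioi t, g u * ENNReal.ofReal (phi n α u) *
        ENNReal.ofReal ((AA (α / n) u - AA (α / n) t) ^ k) := by
  induction k with
  | zero => intro t ht; simp [Hop]
  | succ k ih =>
    intro t ht
    rw [Function.iterate_succ_apply', Nat.factorial_succ, Nat.cast_mul, mul_assoc]
    have mphi := phi_measurable n α
    have mA := AA_measurable (α / n)
    have e1 : (k.factorial : ℝ≥0∞) * Hop n α ((Hop n α)^[k + 1] g) t =
        ∫⁻ s in Ioi t, ∫⁻ u in Ioi s, (g u * ENNReal.ofReal (phi n α u)) *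
          (ENNReal.ofReal (phi n α s) * ENNReal.ofReal ((AA (α / n) u - AA (α / n) s) ^ k)) := by
      unfold Hop
      rw [← lintegral_const_mul' _ _ (by simp)]
      apply setLIntegral_congr_fun measurableSet_Ioi
      intro s hs
      beta_reduce
      rw [← mul_assoc]
      have := ih s (ht.trans hs)
      unfold Hop at this
      rw [this, ← lintegral_mul_const _ (by fun_prop)]
      congr 1; ext u; ring
    rw [e1, tonelli _ (by fun_prop) (Ioi t) (Ioi t) (fun s => Ioi s) (fun u => Ioo t u)
      ?_ measurableSet_Ioi measurableSet_Ioi (fun _ => measurableSet_Ioi)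
      (fun _ => measurableSet_Ioo) ?_]
    · rw [← lintegral_const_mul' _ _ (by simp)]
      apply setLIntegral_congr_fun measurableSet_Ioi
      intro u hu
      beta_reduce
      have hu : t < u := hu
      rw [← ftc_pow_left n α t u k ha ht hu.le, lintegral_const_mul _ (by fun_prop)]
      ring
    · exact (measurableSet_lt measurable_const measurable_fst).inter
        (measurableSet_lt measurable_fst measurable_snd)
    · intro s u
      simp only [mem_Ioi, mem_Ioo]
      constructor
      · rintro ⟨h1, h2⟩; exact ⟨h1.trans h2, h1, h2⟩
      · rintro ⟨_, h1, h2⟩; exact ⟨h1, h2⟩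

lemma R_iter (n : ℕ) (α : ℝ) (ha : 0 < α / n) (f : ℝ → ℝ≥0∞) (hf : Measurable f) (k : ℕ) :
    ∀ t : ℝ, 0 < t → (k.factorial : ℝ≥0∞) * (Rop n α)^[k + 1] f t =
      ENNReal.ofReal (phi n α t) * ∫⁻ u in Ioo 0 t, f u *
        ENNReal.ofReal ((AA (α / n) t - AA (α / n) u) ^ k) := by
  induction k with
  | zero => intro t ht; simp [Rop]
  | succ k ih =>
    intro t ht
    rw [Function.iterate_succ_apply', Nat.factorial_succ, Nat.cast_mul, mul_assoc]
    have mphi := phi_measurable n α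
    have mA := AA_measurable (α / n)
    have e1 : (k.factorial : ℝ≥0∞) * Rop n α ((Rop n α)^[k + 1] f) t =
        ENNReal.ofReal (phi n α t) * ∫⁻ s in Ioo 0 t, ∫⁻ u in Ioo 0 s, f u *
          (ENNReal.ofReal (phi n α s) * ENNReal.ofReal ((AA (α / n) s - AA (α / n) u) ^ k)) := by
      unfold Rop
      rw [mul_left_comm, ← lintegral_const_mul' _ _ (by simp)]
      congr 1
      apply setLIntegral_congr_fun measurableSet_Ioo
      intro s hs
      beta_reduce
      have := ih s hs.1
      unfold Rop at this
      rw [this, ← lintegral_const_mul _ (by fun_prop)]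
      congr 1; ext u; ring
    rw [e1, tonelli _ (by fun_prop) (Ioo 0 t) (Ioo 0 t) (fun s => Ioo 0 s) (fun u => Ioo u t)
      ?_ measurableSet_Ioo measurableSet_Ioo (fun _ => measurableSet_Ioo)
      (fun _ => measurableSet_Ioo) ?_]
    · rw [mul_left_comm, ← lintegral_const_mul' _ _ (by simp)]
      congr 1
      apply setLIntegral_congr_fun measurableSet_Ioo
      intro u hu
      beta_reduce
      rw [← ftc_pow_right n α u t k ha hu.1 hu.2.le, lintegral_const_mul _ (by fun_prop)]
      ring
    · exact (measurableSet_Ioo.preimage measurable_fst).inter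
        ((measurableSet_lt measurable_const measurable_snd).inter
        (measurableSet_lt measurable_snd measurable_fst))
    · intro s u
      simp only [mem_Ioo]
      constructor
      · rintro ⟨⟨h1, h2⟩, h3, h4⟩; exact ⟨⟨h3, h4.trans h2⟩, h4, h2⟩
      · rintro ⟨⟨h1, h2⟩, h3, h4⟩; exact ⟨⟨h1.trans h3, h4⟩, h1, h3⟩

lemma H_iter_anti (n : ℕ) (α : ℝ) (g : ℝ → ℝ≥0∞) (k : ℕ) : Antitone ((Hop n α)^[k + 1] g) := by
  rw [Function.iterate_succ']; exact Hop_anti n α _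

lemma R_dil (n : ℕ) (α : ℝ) (ha : 0 < α / n) (f : ℝ → ℝ≥0∞) (k : ℕ) (s t : ℝ) (hs : 0 < s)
    (hst : s ≤ t) :
    (Rop n α)^[k + 1] f s ≤ ENNReal.ofReal (t / s) * (Rop n α)^[k + 1] f t := by
  rw [Function.iterate_succ']
  have ht := hs.trans_le hst
  show ENNReal.ofReal (phi n α s) * GG _ s ≤ ENNReal.ofReal (t / s) * (ENNReal.ofReal (phi n α t) * GG _ t)
  rw [← mul_assoc, ← ENNReal.ofReal_mul (by positivity)]
  refine mul_le_mul' (ENNReal.ofReal_le_ofReal ?_) (GG_mono _ hst)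
  rw [phi_eq n α s hs, phi_eq n α t ht]
  have := ww_mono ha hs hst
  calc ww (α / n) s / s ≤ ww (α / n) t / s := by gcongr
    _ = _ := by field_simp

/-! Lower bound -/

lemma Hop_mono (n : ℕ) (α : ℝ) {f g : ℝ → ℝ≥0∞} {t : ℝ} (h : ∀ s, t < s → f s ≤ g s) :
    Hop n α f t ≤ Hop n α g t :=
  setLIntegral_mono' measurableSet_Ioi fun s hs => mul_le_mul' (h s hs) le_rfl

lemma Pop_mono {f g : ℝ → ℝ≥0∞} {t : ℝ} (h : ∀ s, 0 < s → f s ≤ g s) :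
    Pop f t ≤ Pop g t :=
  ENNReal.div_le_div_right (setLIntegral_mono' measurableSet_Ioo fun s hs => h s hs.1) _

lemma Rop_mono (n : ℕ) (α : ℝ) {f g : ℝ → ℝ≥0∞} {t : ℝ} (h : ∀ s, 0 < s → f s ≤ g s) :
    Rop n α f t ≤ Rop n α g t :=
  mul_le_mul' le_rfl (setLIntegral_mono' measurableSet_Ioo fun s hs => h s hs.1)

lemma le_Pop {h : ℝ → ℝ≥0∞} (hh : Antitone h) {t : ℝ} (ht : 0 < t) : h t ≤ Pop h t := by
  unfold Pop
  rw [ENNReal.le_div_iff_mul_le (by simp [ht]) (by simp)]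
  calc h t * ENNReal.ofReal t = ∫⁻ s in Ioo 0 t, h t := by simp
    _ ≤ _ := setLIntegral_mono' measurableSet_Ioo fun s hs => hh hs.2.le

lemma H_le (n : ℕ) (α : ℝ) (f : ℝ → ℝ≥0∞) (k : ℕ) : ∀ t : ℝ, 0 < t →
    (Hop n α)^[k + 1] (Pop f) t ≤ (HP n α)^[k + 1] f t := by
  induction k with
  | zero => intro t ht; simp [HP]
  | succ k ih =>
    intro t ht
    rw [Function.iterate_succ_apply', Function.iterate_succ_apply' (HP n α)]
    unfold HP
    refine Hop_mono n α fun s hs => ?_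
    exact (le_Pop (H_iter_anti n α _ k) (ht.trans hs)).trans (Pop_mono ih)

lemma R_le_one (n : ℕ) (α : ℝ) (ha : 0 < α / n) (f : ℝ → ℝ≥0∞) (t : ℝ) (ht : 0 < t) :
    Rop n α f t ≤ 4 * HP n α f t := by
  have h1 : ∫⁻ s in Ioo t (2 * t), GG f t * ENNReal.ofReal (ww (α / n) t / (4 * t ^ 2))
      ≤ HP n α f t := by
    unfold HP Hop
    refine le_trans ?_ (lintegral_mono_set (s := Ioo t (2 * t)) (fun s hs => hs.1))
    refine setLIntegral_mono' measurableSet_Ioo fun s hs => ?_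
    have hs0 : 0 < s := ht.trans hs.1
    rw [phi_eq n α s hs0]
    show _ ≤ GG f s / ENNReal.ofReal s * _
    rw [div_eq_mul_inv (GG f s), ← ENNReal.ofReal_inv_of_pos hs0, mul_assoc,
      ← ENNReal.ofReal_mul (by positivity)]
    refine mul_le_mul' (GG_mono f hs.1.le) (ENNReal.ofReal_le_ofReal ?_)
    have := ww_mono ha ht hs.1.le
    have h0 := ww_pos (a := α / n) ht
    have e : s⁻¹ * (ww (α / n) s / s) = ww (α / n) s / s ^ 2 := by field_simp
    rw [e]
    have h4 : s ^ 2 ≤ 4 * t ^ 2 := by nlinarith [hs.2]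
    have h5 : 0 ≤ ww (α / n) s := h0.le.trans this
    gcongr
  refine le_trans (le_of_eq ?_) (mul_le_mul' le_rfl h1)
  rw [setLIntegral_const, Real.volume_Ioo]
  show ENNReal.ofReal _ * GG f t = _
  rw [mul_assoc, ← ENNReal.ofReal_mul (by have := ww_pos (a := α / n) ht; positivity), mul_left_comm,
    show (4 : ℝ≥0∞) = ENNReal.ofReal 4 by simp, ← ENNReal.ofReal_mul (by norm_num), mul_comm, phi_eq n α t ht]
  congr 2
  field_simp
  ring

lemma R_le (n : ℕ) (α : ℝ) (ha : 0 < α / n) (f : ℝ → ℝ≥0∞) (k : ℕ) : ∀ t : ℝ, 0 < t →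
    (Rop n α)^[k] f t ≤ 4 ^ k * (HP n α)^[k] f t := by
  induction k with
  | zero => intro t ht; simp
  | succ k ih =>
    intro t ht
    rw [Function.iterate_succ_apply', Function.iterate_succ_apply' (HP n α)]
    refine (Rop_mono n α (g := fun s => 4 ^ k * (HP n α)^[k] f s) ih).trans ?_
    have : Rop n α (fun s => 4 ^ k * (HP n α)^[k] f s) t = 4 ^ k * Rop n α ((HP n α)^[k] f) t := by
      unfold Rop
      rw [lintegral_const_mul' _ _ (by finiteness)]; ring
    rw [this, pow_succ, mul_assoc]
    gcongr
    exact R_le_one n α ha _ t ht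

/-! Upper bound -/

lemma Pop_eq (f : ℝ → ℝ≥0∞) {t : ℝ} (ht : 0 < t) : Pop f t = GG f t * ENNReal.ofReal t⁻¹ := by
  rw [ENNReal.ofReal_inv_of_pos ht, ← div_eq_mul_inv]; rfl

lemma Pop_phi_mul (n : ℕ) (α : ℝ) (f : ℝ → ℝ≥0∞) {t : ℝ} (ht : 0 < t) :
    Pop f t * ENNReal.ofReal (phi n α t) * ENNReal.ofReal t = Rop n α f t := by
  rw [Pop_eq f ht, mul_right_comm, mul_assoc (GG f t), ← ENNReal.ofReal_mul (by positivity),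
    inv_mul_cancel₀ ht.ne', ENNReal.ofReal_one, mul_one, mul_comm]
  rfl

lemma swapT (q v : ℝ → ℝ≥0∞) (hq : Measurable q) (hv : Measurable v) (t : ℝ) :
    ∫⁻ s in Ioo 0 t, (∫⁻ r in Ioc s t, q r) * v s = ∫⁻ r in Ioo 0 t, q r * ∫⁻ s in Ioo 0 r, v s := by
  have e1 : ∀ s, (∫⁻ r in Ioc s t, q r) * v s = ∫⁻ r in Ioc s t, q r * v s := fun s =>
    (lintegral_mul_const _ hq).symm
  simp_rw [e1]
  rw [tonelli (fun s r => q r * v s) (by fun_prop) (Ioo 0 t) (Ioc 0 t) (fun s => Ioc s t) (fun u => Ioo 0 u)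
      ?_ measurableSet_Ioo measurableSet_Ioc (fun _ => measurableSet_Ioc)
      (fun _ => measurableSet_Ioo) ?_]
  · rw [← restrict_Ioo_eq_restrict_Ioc]
    congr 1; ext r
    rw [lintegral_const_mul _ hv]
  · exact (measurableSet_Ioo.preimage measurable_fst).inter
        ((measurableSet_lt measurable_fst measurable_snd).inter
        (measurableSet_le measurable_snd measurable_const))
  · intro s u
    simp only [mem_Ioo, mem_Ioc]
    constructor
    · rintro ⟨⟨h1, h2⟩, h3, h4⟩; exact ⟨⟨h1.trans h3, h4⟩, h1, h3⟩
    · rintro ⟨⟨h1, h2⟩, h3, h4⟩; exact ⟨⟨h3, h4.trans_le h2⟩, h4, h2⟩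

lemma Hop_split (n : ℕ) (α : ℝ) (g : ℝ → ℝ≥0∞) {s t : ℝ} (hst : s ≤ t) :
    Hop n α g s = (∫⁻ r in Ioc s t, g r * ENNReal.ofReal (phi n α r)) + Hop n α g t := by
  unfold Hop
  rw [← Ioc_union_Ioi_eq_Ioi hst, lintegral_union measurableSet_Ioi]
  rw [Set.disjoint_left]
  intro x hx hx'
  exact absurd hx.2 (not_le.2 hx')

lemma PHP (n : ℕ) (α : ℝ) (f : ℝ → ℝ≥0∞) {u : ℝ} (hu : 0 < u) :
    Pop (HP n α f) u = HP n α f u + Pop (Rop n α f) u := by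
  have mP := Pop_meas f
  have mphi := phi_measurable n α
  have e : ∫⁻ s in Ioo 0 u, HP n α f s = GG (Rop n α f) u + HP n α f u * ENNReal.ofReal u := by
    have e1 : ∫⁻ s in Ioo 0 u, HP n α f s = ∫⁻ s in Ioo 0 u,
        ((∫⁻ r in Ioc s u, Pop f r * ENNReal.ofReal (phi n α r)) * 1 + HP n α f u) := by
      apply setLIntegral_congr_fun measurableSet_Ioo
      intro s hs
      beta_reduce
      rw [mul_one]
      exact Hop_split n α _ hs.2.le
    rw [e1, lintegral_add_right _ measurable_const,
      swapT (fun r => Pop f r * ENNReal.ofReal (phi n α r)) (fun _ => 1) (by fun_prop) (by fun_prop)]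
    congr 1
    · apply setLIntegral_congr_fun measurableSet_Ioo
      intro s hs
      beta_reduce
      rw [← Pop_phi_mul n α f hs.1]
      simp
    · simp
  rw [Pop_eq _ hu, Pop_eq _ hu]
  unfold GG at e ⊢
  rw [e, add_mul, mul_assoc (HP n α f u), ← ENNReal.ofReal_mul hu.le, mul_inv_cancel₀ hu.ne']
  simp [add_comm]

lemma GG_R_le (n : ℕ) (α : ℝ) (ha : 0 < α / n) (f : ℝ → ℝ≥0∞) {t u : ℝ} (ht : 0 < t) (htu : t ≤ u) :
    GG (Rop n α f) u ≤ GG (Rop n α f) t +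
      GG f u * ENNReal.ofReal (AA (α / n) u - AA (α / n) t) := by
  have mphi := phi_measurable n α
  unfold GG
  have hs : Ioo 0 u ⊆ Ioo 0 t ∪ Ico t u := by
    intro x hx
    rcases lt_or_ge x t with h | h
    · exact Or.inl ⟨hx.1, h⟩
    · exact Or.inr ⟨h, hx.2⟩
  refine (lintegral_mono_set hs).trans ((lintegral_union_le _ _ _).trans ?_)
  gcongr
  rw [← restrict_Ioo_eq_restrict_Ico, ← ftc_phi n α t u ha ht htu,
    ← lintegral_const_mul _ (by fun_prop)]
  refine setLIntegral_mono' measurableSet_Ioo fun s hs => ?_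
  rw [mul_comm _ (ENNReal.ofReal (phi n α s))]
  exact mul_le_mul' le_rfl (GG_mono f hs.2.le)

lemma GG_R_small (n : ℕ) (α : ℝ) (ha : 0 < α / n) (f : ℝ → ℝ≥0∞) {t : ℝ} (ht : 0 < t) (ht1 : t ≤ 1) :
    GG (Rop n α f) t ≤ GG f t * ENNReal.ofReal (ww (α / n) t / (α / n)) := by
  have h1 : ww (α / n) t = t ^ (α / n) := min_eq_left (Real.rpow_le_one ht.le ht1 ha.le)
  rw [h1, ← lint_rpow _ t ha ht, ← lintegral_const_mul _ (by fun_prop)]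
  refine setLIntegral_mono' measurableSet_Ioo fun s hs => ?_
  unfold Rop
  rw [mul_comm]
  refine mul_le_mul' (GG_mono f hs.2.le) (ENNReal.ofReal_le_ofReal ?_)
  unfold phi
  rw [neg_add_eq_sub]
  exact min_le_left _ _

lemma X2 (n : ℕ) (α : ℝ) (ha : 0 < α / n) (ha1 : α / n < 1) (j : ℕ) :
    ∃ C : ℝ≥0∞, C ≠ ⊤ ∧ ∀ f : ℝ → ℝ≥0∞, Measurable f → ∀ t : ℝ, 0 < t →
      (j.factorial : ℝ≥0∞) * (Hop n α)^[j + 1] (Pop (Rop n α f)) t ≤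
        C * ((Hop n α)^[j + 2] (Pop f) (t / 2) + (Rop n α)^[j + 2] f (2 * t)) := by
  obtain ⟨K, hK, hKb⟩ := log_pow_bound j
  have mphi := phi_measurable n α
  have mA := AA_measurable (α / n)
  set a := α / n with hadef
  set A := AA a with hA
  refine ⟨((j + 1).factorial : ℝ≥0∞) + (ENNReal.ofReal (4 / a) * ((j + 1).factorial : ℝ≥0∞) +
    ENNReal.ofReal (2 * K * 2 ^ (j + 1)) * (j.factorial : ℝ≥0∞)), by finiteness, ?_⟩
  intro f hf t ht
  have mP := Pop_meas f
  have mG := GG_meas f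
  rw [H_iter n α ha _ (Pop_meas _) j t ht]
  set B := GG (Rop n α f) t with hB
  set X := (Hop n α)^[j + 2] (Pop f) (t / 2) with hX
  set Y := (Rop n α)^[j + 2] f (2 * t) with hY
  set I1 := ∫⁻ u in Ioi t, B * ENNReal.ofReal (u⁻¹ * phi n α u * (A u - A t) ^ j) with hI1
  have hHX : ∫⁻ u in Ioi (t / 2), Pop f u * ENNReal.ofReal (phi n α u) *
        ENNReal.ofReal ((A u - A (t / 2)) ^ (j + 1)) = ((j + 1).factorial : ℝ≥0∞) * X :=
    (H_iter n α ha _ mP (j + 1) (t / 2) (by positivity)).symm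
  have step1 : ∫⁻ u in Ioi t, Pop (Rop n α f) u * ENNReal.ofReal (phi n α u) *
        ENNReal.ofReal ((A u - A t) ^ j) ≤ I1 + ((j + 1).factorial : ℝ≥0∞) * X := by
    calc _ ≤ ∫⁻ u in Ioi t, (B * ENNReal.ofReal (u⁻¹ * phi n α u * (A u - A t) ^ j) +
          Pop f u * ENNReal.ofReal (phi n α u) * ENNReal.ofReal ((A u - A t) ^ (j + 1))) := by
          refine setLIntegral_mono' measurableSet_Ioi fun u hu => ?_
          have hu' : t < u := hu
          have hu0 : 0 < u := ht.trans hu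
          have hA0 : 0 ≤ A u - A t := sub_nonneg.2 (AA_mono ha ht hu'.le)
          have hp0 := phi_nonneg n α u hu0
          rw [Pop_eq _ hu0, Pop_eq _ hu0, ENNReal.ofReal_mul (by positivity),
            ENNReal.ofReal_mul (by positivity), pow_succ, ENNReal.ofReal_mul (by positivity)]
          calc _ ≤ (B + GG f u * ENNReal.ofReal (A u - A t)) * ENNReal.ofReal u⁻¹ *
                ENNReal.ofReal (phi n α u) * ENNReal.ofReal ((A u - A t) ^ j) := by
                gcongr; exact GG_R_le n α ha f ht hu'.le
            _ = _ := by ring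
      _ = I1 + ∫⁻ u in Ioi t, Pop f u * ENNReal.ofReal (phi n α u) *
            ENNReal.ofReal ((A u - A t) ^ (j + 1)) := lintegral_add_left (by fun_prop) _
      _ ≤ I1 + ((j + 1).factorial : ℝ≥0∞) * X := by
          gcongr
          rw [← H_iter n α ha _ mP (j + 1) t ht]
          gcongr
          exact H_iter_anti n α _ (j + 1) (by linarith)
  have step2 : I1 ≤ ENNReal.ofReal (4 / a) * ((j + 1).factorial : ℝ≥0∞) * X +
      ENNReal.ofReal (2 * K * 2 ^ (j + 1)) * (j.factorial : ℝ≥0∞) * Y := by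
    rcases le_total t 1 with h1 | h1
    · refine le_trans ?_ le_self_add
      rw [mul_assoc, ← hHX, ← lintegral_const_mul _ (by fun_prop)]
      refine le_trans ?_ (lintegral_mono_set (Ioi_subset_Ioi (by linarith : t / 2 ≤ t)))
      refine setLIntegral_mono' measurableSet_Ioi fun u hu => ?_
      have hu' : t < u := hu
      have hu0 : 0 < u := ht.trans hu
      have hp0 := phi_nonneg n α u hu0
      have hA0 : 0 ≤ A u - A t := sub_nonneg.2 (AA_mono ha ht hu'.le)
      have hA1 : 0 ≤ A t - A (t / 2) := sub_nonneg.2 (AA_mono ha (by positivity) (by linarith))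
      have hA2 := AA_half n α t ha ha1 ht
      rw [← hadef, ← hA] at hA2
      calc B * ENNReal.ofReal (u⁻¹ * phi n α u * (A u - A t) ^ j)
          ≤ (GG f u * ENNReal.ofReal (ww a t / a)) *
            ENNReal.ofReal (u⁻¹ * phi n α u * (A u - A t) ^ j) := by
            gcongr
            exact (GG_R_small n α ha f ht h1).trans (mul_le_mul' (GG_mono f hu'.le) le_rfl)
        _ = GG f u * ENNReal.ofReal (ww a t / a * (u⁻¹ * phi n α u * (A u - A t) ^ j)) := by
            rw [mul_assoc, ← ENNReal.ofReal_mul]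
            have := ww_pos (a := a) ht
            positivity
        _ ≤ GG f u * ENNReal.ofReal ((4 * (A u - A (t / 2))) / a *
              (u⁻¹ * phi n α u * (A u - A (t / 2)) ^ j)) := by
            have hA3 : 0 ≤ A u - A (t / 2) := by linarith
            gcongr
            all_goals linarith
        _ = _ := by
            have hA3 : 0 ≤ A u - A (t / 2) := by linarith
            rw [Pop_eq _ hu0, mul_assoc (GG f u), mul_assoc (GG f u), ← ENNReal.ofReal_mul (by positivity),
              ← ENNReal.ofReal_mul (by positivity), mul_left_comm (ENNReal.ofReal _) (GG f u), ← ENNReal.ofReal_mul (by positivity)]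
            congr 2
            ring
    · refine le_trans ?_ le_add_self
      have hw : ww a t = 1 := min_eq_right (Real.one_le_rpow h1 ha.le)
      have hphi : phi n α t = t⁻¹ := by rw [phi_eq n α t ht, ← hadef, hw, one_div]
      have b1 : I1 ≤ B * ENNReal.ofReal (2 * K * t⁻¹) := by
        rw [hI1, lintegral_const_mul _ (by fun_prop)]
        gcongr
        calc _ ≤ ∫⁻ u in Ioi t, ENNReal.ofReal (K * t ^ (-1/2 : ℝ)) * ENNReal.ofReal (u ^ (-3/2 : ℝ)) := by
              refine setLIntegral_mono' measurableSet_Ioi fun u hu => ?_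
              have hu' : t < u := hu
              have hu0 : 0 < u := ht.trans hu
              rw [← ENNReal.ofReal_mul (by positivity)]
              apply ENNReal.ofReal_le_ofReal
              have hA0 : 0 ≤ A u - A t := sub_nonneg.2 (AA_mono ha ht hu'.le)
              have hl : 0 ≤ Real.log (u / t) := Real.log_nonneg (by rw [le_div_iff₀ ht]; linarith)
              have c1 : A u - A t ≤ 1 + 2 * Real.log (u / t) := by
                have := AA_sub_le n α t u ha ht hu'.le
                rw [← hadef, ← hA] at this
                have h2 := ww_le_one a u
                nlinarith
              have c2 : phi n α u ≤ u⁻¹ := min_le_right _ _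
              have c3 := hKb (u / t) (by rw [le_div_iff₀ ht]; linarith)
              calc u⁻¹ * phi n α u * (A u - A t) ^ j ≤ u⁻¹ * u⁻¹ * (K * (u / t) ^ (1/2 : ℝ)) := by
                    have := phi_nonneg n α u hu0
                    gcongr
                    exact (pow_le_pow_left₀ hA0 c1 j).trans c3
                _ = _ := by
                    rw [Real.div_rpow hu0.le ht.le, show (-1/2 : ℝ) = -(1/2) by norm_num,
                      Real.rpow_neg ht.le, show (-3/2 : ℝ) = 1/2 - 2 by norm_num, Real.rpow_sub hu0]
                    norm_num
                    field_simp
          _ = _ := by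
              rw [lintegral_const_mul _ (by fun_prop), lint_tail t ht, ← ENNReal.ofReal_mul (by positivity)]
              congr 1
              have : t ^ (-1/2 : ℝ) * t ^ (-1/2 : ℝ) = t⁻¹ := by
                rw [← Real.rpow_add ht]; norm_num; rw [Real.rpow_neg_one]
              linear_combination 2 * K * this
      refine b1.trans ?_
      have b2 : ENNReal.ofReal (t⁻¹ / 2 ^ (j + 1)) * B ≤ (j.factorial : ℝ≥0∞) * Y := by
        have := R_iter n α ha (Rop n α f) (Rop_meas n α f) j (2 * t) (by positivity)
        rw [← Function.iterate_succ_apply] at this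
        rw [hY, this]
        have d1 : t⁻¹ / 2 ≤ phi n α (2 * t) := by
          rw [phi_eq n α _ (by positivity : 0 < 2 * t), ← hadef]
          have := ww_mono ha ht (by linarith : t ≤ 2 * t)
          rw [hw] at this
          calc t⁻¹ / 2 = 1 / (2 * t) := by field_simp
            _ ≤ _ := by gcongr
        have d2 : ENNReal.ofReal ((1/2) ^ j) * B ≤ ∫⁻ u in Ioo 0 (2 * t), Rop n α f u *
            ENNReal.ofReal ((A (2 * t) - A u) ^ j) := by
          refine le_trans ?_ (lintegral_mono_set (Ioo_subset_Ioo_right (by linarith : t ≤ 2 * t)))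
          rw [hB, GG, ← lintegral_const_mul _ (Rop_meas n α f)]
          refine setLIntegral_mono' measurableSet_Ioo fun u hu => ?_
          rw [mul_comm]
          gcongr
          have e1 := AA_double n α t ha ht
          rw [← hadef, hw, ← hA] at e1
          have e2 : A u ≤ A t := AA_mono ha hu.1 hu.2.le
          linarith
        calc ENNReal.ofReal (t⁻¹ / 2 ^ (j + 1)) * B
            = ENNReal.ofReal (t⁻¹ / 2) * (ENNReal.ofReal ((1/2) ^ j) * B) := by
              rw [← mul_assoc, ← ENNReal.ofReal_mul (by positivity)]
              congr 2
              rw [pow_succ, one_div, inv_pow]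
              field_simp
          _ ≤ _ := mul_le_mul' (ENNReal.ofReal_le_ofReal d1) d2
      calc B * ENNReal.ofReal (2 * K * t⁻¹)
          = ENNReal.ofReal (2 * K * 2 ^ (j + 1)) * (ENNReal.ofReal (t⁻¹ / 2 ^ (j + 1)) * B) := by
            rw [← mul_assoc, ← ENNReal.ofReal_mul (by positivity), mul_comm]
            congr 2
            field_simp
        _ ≤ _ := by rw [mul_assoc _ _ Y]; exact mul_le_mul' le_rfl b2
  refine step1.trans ((add_le_add_left step2 _).trans ?_)
  generalize ((j + 1).factorial : ℝ≥0∞) = p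
  generalize ENNReal.ofReal (4 / a) * p = q
  generalize ENNReal.ofReal (2 * K * 2 ^ (j + 1)) * (j.factorial : ℝ≥0∞) = r
  calc q * X + r * Y + p * X ≤ q * X + r * Y + p * X + (p * Y + q * Y + r * X) := le_self_add
    _ = _ := by ring

lemma X1 (n : ℕ) (α : ℝ) (ha : 0 < α / n) (ha1 : α / n < 1) (j : ℕ) :
    ∃ C : ℝ≥0∞, C ≠ ⊤ ∧ ∀ f : ℝ → ℝ≥0∞, Measurable f → ∀ t : ℝ, 0 < t →
      (Hop n α)^[j + 1] (Pop (HP n α f)) t ≤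
        C * ((Hop n α)^[j + 2] (Pop f) (t / 2) + (Rop n α)^[j + 2] f (2 * t)) := by
  obtain ⟨C, hC, h⟩ := X2 n α ha ha1 j
  have mphi := phi_measurable n α
  have mA := AA_measurable (α / n)
  refine ⟨j.factorial + C, by finiteness, fun f hf t ht => ?_⟩
  have mH : Measurable (HP n α f) := Hop_meas n α _
  calc (Hop n α)^[j + 1] (Pop (HP n α f)) t
      ≤ (j.factorial : ℝ≥0∞) * (Hop n α)^[j + 1] (Pop (HP n α f)) t := by
        refine le_mul_of_one_le_left' ?_
        exact_mod_cast Nat.one_le_iff_ne_zero.2 j.factorial_ne_zero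
    _ = (j.factorial : ℝ≥0∞) * (Hop n α)^[j + 1] (HP n α f) t +
        (j.factorial : ℝ≥0∞) * (Hop n α)^[j + 1] (Pop (Rop n α f)) t := by
        rw [H_iter n α ha _ (Pop_meas _) j t ht, H_iter n α ha _ (Pop_meas _) j t ht,
          H_iter n α ha _ mH j t ht, ← lintegral_add_left (by fun_prop)]
        apply setLIntegral_congr_fun measurableSet_Ioi
        intro u hu
        beta_reduce
        rw [PHP n α f (ht.trans hu)]
        ring
    _ ≤ j.factorial * ((Hop n α)^[j + 2] (Pop f) (t / 2) + (Rop n α)^[j + 2] f (2 * t)) +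
        C * ((Hop n α)^[j + 2] (Pop f) (t / 2) + (Rop n α)^[j + 2] f (2 * t)) := by
        refine add_le_add (mul_le_mul' le_rfl ?_) ?_
        · refine le_trans ?_ le_self_add
          exact H_iter_anti n α (Pop f) (j + 1) (by linarith : t / 2 ≤ t)
        · exact h f hf t ht
    _ = _ := by ring

lemma Y0 (n : ℕ) (α : ℝ) (ha : 0 < α / n) (j : ℕ) (K : ℝ) (hK : 0 < K)
    (hKb : ∀ x : ℝ, 1 ≤ x → (1 + 2 * Real.log x) ^ j ≤ K * x ^ (1 / 2 : ℝ)) (u t : ℝ) (hu : 0 < u)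
    (hut : u ≤ t) :
    ∫⁻ s in Ioo 0 u, ENNReal.ofReal ((AA (α / n) t - AA (α / n) s) ^ j) ≤
      ENNReal.ofReal (2 * K * u * (AA (α / n) (2 * t) - AA (α / n) u) ^ j) := by
  set a := α / n with hadef
  set A := AA a with hA
  set D := A (2 * t) - A u with hD
  have hD1 : ww a u ≤ 2 * D := by
    have e1 := AA_double n α u ha hu
    have e2 : A (2 * u) ≤ A (2 * t) := AA_mono ha (by positivity) (by linarith)
    rw [← hadef, ← hA] at e1
    linarith
  have hw := ww_pos (a := a) hu
  have hD0 : 0 ≤ D := by linarith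
  calc _ ≤ ∫⁻ s in Ioo 0 u, ENNReal.ofReal (K * u ^ (1/2 : ℝ) * D ^ j) * ENNReal.ofReal (s ^ ((1/2 : ℝ) - 1)) := by
        refine setLIntegral_mono' measurableSet_Ioo fun s hs => ?_
        have hs0 := hs.1
        rw [← ENNReal.ofReal_mul (by positivity)]
        apply ENNReal.ofReal_le_ofReal
        have hus : 1 ≤ u / s := by rw [le_div_iff₀ hs0]; linarith [hs.2]
        have hl := Real.log_nonneg hus
        have c0 : A s ≤ A t := AA_mono ha hs0 (hs.2.le.trans hut)
        have c1 : A t - A s ≤ D * (1 + 2 * Real.log (u / s)) := by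
          have e1 := AA_sub_le n α s u ha hs0 hs.2.le
          rw [← hadef, ← hA] at e1
          have e2 : A t ≤ A (2 * t) := AA_mono ha (by linarith) (by linarith)
          have e3 : ww a u * Real.log (u / s) ≤ 2 * D * Real.log (u / s) := by gcongr
          have : A t - A s ≤ D + (A u - A s) := by rw [hD]; linarith
          linarith
        calc (A t - A s) ^ j ≤ (D * (1 + 2 * Real.log (u / s))) ^ j :=
              pow_le_pow_left₀ (by linarith) c1 j
          _ = D ^ j * (1 + 2 * Real.log (u / s)) ^ j := mul_pow _ _ _
          _ ≤ D ^ j * (K * (u / s) ^ (1/2 : ℝ)) := by gcongr; exact hKb _ hus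
          _ = _ := by
            rw [Real.div_rpow hu.le hs0.le, show (1/2 : ℝ) - 1 = -(1/2) by norm_num,
              Real.rpow_neg hs0.le]
            ring
    _ = _ := by
      rw [lintegral_const_mul _ (by fun_prop), lint_rpow _ u (by norm_num) hu, ← ENNReal.ofReal_mul (by positivity)]
      congr 1
      have : u ^ (1/2 : ℝ) * u ^ (1/2 : ℝ) = u := by
        rw [← Real.rpow_add hu]; norm_num
      linear_combination 2 * K * D ^ j * this

lemma Y1 (n : ℕ) (α : ℝ) (ha : 0 < α / n) (ha1 : α / n < 1) (j : ℕ) :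
    ∃ C : ℝ≥0∞, C ≠ ⊤ ∧ ∀ f : ℝ → ℝ≥0∞, Measurable f → ∀ t : ℝ, 0 < t →
      (Rop n α)^[j + 1] (HP n α f) t ≤
        C * ((Hop n α)^[j + 2] (Pop f) (t / 2) + (Rop n α)^[j + 2] f (2 * t)) := by
  obtain ⟨K, hK, hKb⟩ := log_pow_bound j
  have mphi := phi_measurable n α
  have mA := AA_measurable (α / n)
  set a := α / n with hadef
  set A := AA a with hA
  refine ⟨ENNReal.ofReal (2 * K * 2 ^ j * 4 ^ (j + 1)) * ((j + 1).factorial : ℝ≥0∞) +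
    ENNReal.ofReal (4 * K) * (j.factorial : ℝ≥0∞), by finiteness, ?_⟩
  intro f hf t ht
  have mP := Pop_meas f
  have mG := GG_meas f
  have mH : Measurable (HP n α f) := Hop_meas n α _
  have mR := Rop_meas n α f
  set X := (Hop n α)^[j + 2] (Pop f) (t / 2) with hX
  set Y := (Rop n α)^[j + 2] f (2 * t) with hY
  have hHX : ∫⁻ u in Ioi (t / 2), Pop f u * ENNReal.ofReal (phi n α u) *
        ENNReal.ofReal ((A u - A (t / 2)) ^ (j + 1)) = ((j + 1).factorial : ℝ≥0∞) * X :=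
    (H_iter n α ha _ mP (j + 1) (t / 2) (by positivity)).symm
  have hRY : ENNReal.ofReal (phi n α (2 * t)) * ∫⁻ u in Ioo 0 (2 * t), Rop n α f u *
        ENNReal.ofReal ((A (2 * t) - A u) ^ j) = (j.factorial : ℝ≥0∞) * Y := by
    have := R_iter n α ha (Rop n α f) (Rop_meas n α f) j (2 * t) (by positivity)
    rw [← Function.iterate_succ_apply] at this
    exact this.symm
  have hpt := phi_nonneg n α t ht
  have hwt := ww_pos (a := a) ht
  have e0 : (j.factorial : ℝ≥0∞) * (Rop n α)^[j + 1] (HP n α f) t =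
      ENNReal.ofReal (phi n α t) * (∫⁻ s in Ioo 0 t, ((∫⁻ r in Ioc s t, Pop f r * ENNReal.ofReal (phi n α r)) *
        ENNReal.ofReal ((A t - A s) ^ j))) + ENNReal.ofReal (phi n α t) * (HP n α f t * ∫⁻ s in Ioo 0 t, ENNReal.ofReal ((A t - A s) ^ j)) := by
    rw [R_iter n α ha _ mH j t ht, ← mul_add, ← lintegral_const_mul (HP n α f t) (by fun_prop),
      ← lintegral_add_right _ (by fun_prop)]
    congr 1
    apply setLIntegral_congr_fun measurableSet_Ioo
    intro s hs
    beta_reduce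
    rw [← add_mul]
    congr 1
    exact Hop_split n α _ hs.2.le
  have t1 : ENNReal.ofReal (phi n α t) * (∫⁻ s in Ioo 0 t, ((∫⁻ r in Ioc s t, Pop f r * ENNReal.ofReal (phi n α r)) *
        ENNReal.ofReal ((A t - A s) ^ j))) ≤ ENNReal.ofReal (4 * K) * (j.factorial : ℝ≥0∞) * Y := by
    rw [swapT (fun r => Pop f r * ENNReal.ofReal (phi n α r)) (fun s => ENNReal.ofReal ((A t - A s) ^ j))
      (by fun_prop) (by fun_prop)]
    have b1 : ∫⁻ r in Ioo 0 t, Pop f r * ENNReal.ofReal (phi n α r) * ∫⁻ s in Ioo 0 r, ENNReal.ofReal ((A t - A s) ^ j)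
        ≤ ENNReal.ofReal (2 * K) * ∫⁻ u in Ioo 0 (2 * t), Rop n α f u *
        ENNReal.ofReal ((A (2 * t) - A u) ^ j) := by
      rw [← lintegral_const_mul _ (by fun_prop)]
      refine le_trans ?_ (lintegral_mono_set (Ioo_subset_Ioo_right (by linarith : t ≤ 2 * t)))
      refine setLIntegral_mono' measurableSet_Ioo fun r hr => ?_
      refine (mul_le_mul' le_rfl (Y0 n α ha j K hK hKb r t hr.1 hr.2.le)).trans (le_of_eq ?_)
      have hr0 := hr.1
      rw [← Pop_phi_mul n α f hr.1, ← hadef, ← hA, ENNReal.ofReal_mul (by positivity), ENNReal.ofReal_mul (by positivity)]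
      ring
    have b2 : ENNReal.ofReal (phi n α t) ≤ ENNReal.ofReal 2 * ENNReal.ofReal (phi n α (2 * t)) := by
      rw [← ENNReal.ofReal_mul (by norm_num)]
      apply ENNReal.ofReal_le_ofReal
      rw [phi_eq n α t ht, phi_eq n α (2 * t) (by positivity), ← hadef]
      have := ww_mono ha ht (by linarith : t ≤ 2 * t)
      calc ww a t / t ≤ ww a (2 * t) / t := by gcongr
        _ = _ := by field_simp
    refine (mul_le_mul' b2 b1).trans (le_of_eq ?_)
    have e4 : ENNReal.ofReal (4 * K) = ENNReal.ofReal 2 * ENNReal.ofReal (2 * K) := by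
      rw [← ENNReal.ofReal_mul (by norm_num)]; congr 1; ring
    rw [mul_assoc _ _ Y, ← hRY, e4, mul_mul_mul_comm]
  have t2 : ENNReal.ofReal (phi n α t) * (HP n α f t * ∫⁻ s in Ioo 0 t, ENNReal.ofReal ((A t - A s) ^ j)) ≤
      ENNReal.ofReal (2 * K * 2 ^ j * 4 ^ (j + 1)) * ((j + 1).factorial : ℝ≥0∞) * X := by
    have b1 := Y0 n α ha j K hK hKb t t ht le_rfl
    rw [← hadef, ← hA] at b1
    have hD0 : 0 ≤ A (2 * t) - A t := sub_nonneg.2 (AA_mono ha ht (by linarith))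
    have hD : A (2 * t) - A t ≤ 2 * ww a t := by
      have e1 := AA_sub_le n α t (2 * t) ha ht (by linarith)
      rw [← hadef, ← hA, mul_div_assoc, div_self ht.ne', mul_one] at e1
      have e2 := ww_half ha ha1 (by positivity : 0 < 2 * t)
      rw [mul_div_cancel_left₀ _ (by norm_num : (2:ℝ) ≠ 0)] at e2
      have := Real.log_two_lt_d9
      have e3 := ww_pos (a := a) (by positivity : 0 < 2 * t)
      nlinarith
    have b2 : ∫⁻ s in Ioo 0 t, ENNReal.ofReal ((A t - A s) ^ j) ≤ ENNReal.ofReal (2 * K * t * (2 * ww a t) ^ j) := by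
      refine b1.trans (ENNReal.ofReal_le_ofReal ?_)
      gcongr
    calc _ ≤ ENNReal.ofReal (phi n α t) * (HP n α f t * ENNReal.ofReal (2 * K * t * (2 * ww a t) ^ j)) := by gcongr
      _ = HP n α f t * ENNReal.ofReal (2 * K * 2 ^ j * ww a t ^ (j + 1)) := by
        rw [mul_left_comm, ← ENNReal.ofReal_mul hpt, phi_eq n α t ht, ← hadef]
        congr 2
        rw [mul_pow]
        field_simp
        ring
      _ = ∫⁻ u in Ioi t, Pop f u * ENNReal.ofReal (phi n α u) * ENNReal.ofReal (2 * K * 2 ^ j * ww a t ^ (j + 1)) := by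
        rw [lintegral_mul_const _ (by fun_prop)]; rfl
      _ ≤ _ := by
        rw [mul_assoc _ _ X, ← hHX, ← lintegral_const_mul _ (by fun_prop)]
        refine le_trans ?_ (lintegral_mono_set (Ioi_subset_Ioi (by linarith : t / 2 ≤ t)))
        refine setLIntegral_mono' measurableSet_Ioi fun u hu => ?_
        have hu' : t < u := hu
        have c1 : A t ≤ A u := AA_mono ha ht hu'.le
        have c2 := AA_half n α t ha ha1 ht
        rw [← hadef, ← hA] at c2
        rw [mul_left_comm, ← ENNReal.ofReal_mul (by positivity)]
        gcongr _ * ENNReal.ofReal ?_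
        calc 2 * K * 2 ^ j * ww a t ^ (j + 1) ≤ 2 * K * 2 ^ j * (4 * (A u - A (t / 2))) ^ (j + 1) := by
              gcongr
              linarith
          _ = _ := by rw [mul_pow]; ring
  calc (Rop n α)^[j + 1] (HP n α f) t
      ≤ (j.factorial : ℝ≥0∞) * (Rop n α)^[j + 1] (HP n α f) t := by
        refine le_mul_of_one_le_left' ?_
        exact_mod_cast Nat.one_le_iff_ne_zero.2 j.factorial_ne_zero
    _ ≤ _ := by
        rw [e0]
        refine (add_le_add t1 t2).trans ?_
        generalize ENNReal.ofReal (4 * K) * (j.factorial : ℝ≥0∞) = p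
        generalize ENNReal.ofReal (2 * K * 2 ^ j * 4 ^ (j + 1)) * ((j + 1).factorial : ℝ≥0∞) = q
        calc p * Y + q * X ≤ p * Y + q * X + (p * X + q * Y) := le_self_add
          _ = _ := by ring

lemma upper (n : ℕ) (α : ℝ) (ha : 0 < α / n) (ha1 : α / n < 1) (j : ℕ) :
    ∃ C : ℝ≥0∞, C ≠ ⊤ ∧ ∀ f : ℝ → ℝ≥0∞, Measurable f → ∀ t : ℝ, 0 < t →
      (HP n α)^[j + 1] f t ≤
        C * ((Hop n α)^[j + 1] (Pop f) (t / 2 ^ j) + (Rop n α)^[j + 1] f (2 ^ j * t)) := by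
  induction j with
  | zero => exact ⟨1, by simp, fun f hf t ht => by simp [HP]⟩
  | succ j ih =>
    obtain ⟨C, hC, h⟩ := ih
    obtain ⟨C1, hC1, h1⟩ := X1 n α ha ha1 j
    obtain ⟨C2, hC2, h2⟩ := Y1 n α ha ha1 j
    refine ⟨C * (C1 * (1 + ENNReal.ofReal (4 ^ j)) + C2), by finiteness, fun f hf t ht => ?_⟩
    rw [Function.iterate_succ_apply]
    refine (h (HP n α f) (Hop_meas n α _) t ht).trans ?_
    rw [mul_assoc]
    gcongr
    have hp : (0:ℝ) < 2 ^ j := by positivity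
    have hp1 : (1:ℝ) ≤ 2 ^ j := one_le_pow₀ (by norm_num)
    set X := (Hop n α)^[j + 1 + 1] (Pop f) (t / 2 ^ (j + 1)) with hX
    set Y := (Rop n α)^[j + 1 + 1] f (2 ^ (j + 1) * t) with hY
    have b1 := h1 f hf (t / 2 ^ j) (by positivity)
    have b2 := h2 f hf (2 ^ j * t) (by positivity)
    have x1 : (Hop n α)^[j + 2] (Pop f) (t / 2 ^ j / 2) = X := by
      rw [hX, div_div, ← pow_succ]
    have y2 : (Rop n α)^[j + 2] f (2 * (2 ^ j * t)) = Y := by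
      rw [hY, ← mul_assoc, ← pow_succ']
    have x2 : (Hop n α)^[j + 2] (Pop f) (2 ^ j * t / 2) ≤ X := by
      apply H_iter_anti n α _ (j + 1)
      rw [pow_succ, div_le_div_iff₀ (by positivity) (by positivity)]
      have : 1 ≤ (2:ℝ) ^ j * 2 ^ j := one_le_mul_of_one_le_of_one_le hp1 hp1
      nlinarith
    have y1 : (Rop n α)^[j + 2] f (2 * (t / 2 ^ j)) ≤ ENNReal.ofReal (4 ^ j) * Y := by
      refine (R_dil n α ha f (j + 1) (2 * (t / 2 ^ j)) (2 ^ (j + 1) * t) (by positivity) ?_).trans (le_of_eq ?_)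
      · rw [pow_succ', mul_assoc]
        gcongr
        rw [div_le_iff₀ hp]
        have : 1 ≤ (2:ℝ) ^ j * 2 ^ j := one_le_mul_of_one_le_of_one_le hp1 hp1
        nlinarith
      · rw [hY]
        congr 2
        rw [show (4:ℝ) = 2 * 2 by norm_num, mul_pow, pow_succ]
        field_simp
    rw [x1] at b1
    rw [y2] at b2
    generalize hE : ENNReal.ofReal (4 ^ j) = E at *
    calc _ ≤ C1 * (X + E * Y) + C2 * (X + Y) :=
          add_le_add (b1.trans (by gcongr)) (b2.trans (by gcongr))
      _ ≤ C1 * (X + E * Y) + C2 * (X + Y) + C1 * (Y + E * X) := le_self_add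
      _ = _ := by ring

theorem stmt9 (n : ℕ) (hn : 2 ≤ n) (α : ℝ) (hα0 : 0 < α) (hαn : α < n) (j : ℕ) :
    ∃ c C : ℝ, 0 < c ∧ 0 < C ∧
      ∀ f : ℝ → ℝ≥0∞, Measurable f → ∀ t : ℝ, 0 < t →
        ENNReal.ofReal c * ((Hop n α)^[j + 1] (Pop f) t + (Rop n α)^[j + 1] f t) ≤
            (HP n α)^[j + 1] f t ∧
          (HP n α)^[j + 1] f t ≤
            ENNReal.ofReal C *
              ((Hop n α)^[j + 1] (Pop f) (t / 2 ^ j) +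
                (Rop n α)^[j + 1] f (2 ^ j * t)) := by
  have hn0 : (0:ℝ) < n := by exact_mod_cast (by omega : 0 < n)
  have ha : 0 < α / n := by positivity
  have ha1 : α / n < 1 := by rwa [div_lt_one hn0]
  obtain ⟨C, hC, h⟩ := upper n α ha ha1 j
  refine ⟨(1 + 4 ^ (j + 1))⁻¹, C.toReal + 1, by positivity, by positivity, fun f hf t ht => ⟨?_, ?_⟩⟩
  · have h1 := H_le n α f j t ht
    have h2 := R_le n α ha f (j + 1) t ht
    rw [ENNReal.ofReal_inv_of_pos (by positivity), mul_comm, ← div_eq_mul_inv]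
    refine ENNReal.div_le_of_le_mul ?_
    have e : ENNReal.ofReal (1 + 4 ^ (j + 1)) = 1 + 4 ^ (j + 1) := by
      rw [ENNReal.ofReal_add (by norm_num) (by positivity), ENNReal.ofReal_pow (by norm_num)]
      simp
    rw [e, mul_add, mul_one, mul_comm _ (4 ^ (j + 1))]
    exact add_le_add h1 h2
  · refine (h f hf t ht).trans ?_
    gcongr
    rw [← ENNReal.ofReal_toReal hC]
    apply ENNReal.ofReal_le_ofReal
    simp
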